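/- Let (Y,ξ) be a contact three-manifold containing an embedded copy of Q(1+ε) for some ε>0, and let α be a contact form on Y agreeing with dt−λ on Q(1+ε') for some 0<ε'<ε. Then (Y,α) contains an embedded Legendrian Λ₀ such that for every δ>0 there is a regular homotopy Λ_t of Legendrian immersions starting at Λ₀, with oscillation energy less than δ, and with no Reeb chords between Λ₀ and Λ₁. -/

import Mathlib

/-!
# Statement 4: Disjoining a Legendrian by regular homotopies of arbitrarily small
  oscillation energy (Theorem 4 of the paper)

The local model `Q(a) = ℝ/ℤ × B(a)` with contact form `dt - λ`, `λ = ½(x dy - y dx)`,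
is treated concretely; in this model Legendrian (immersed) loops and their regular
homotopies are parametrized by `1`-periodic pairs `(F, j) : ℝ → ℝ × ℂ` satisfying the
Legendrian condition `∂ₛF = λ_j(∂ₛj)`, and the contact Hamiltonian of a family is
`h_t(s) = ∂ₜF - λ_j(∂ₜj)`.  The ambient contact three-manifold `(Y, α)` is axiomatized
(contact geometry being unavailable in Mathlib) by its dimension, its Reeb flow, and
predicates for Legendrians and regular homotopies of Legendrians with their contact
Hamiltonians; the hypotheses below state that `α` agrees with `dt - λ` on the embedded
copy of `Q(1+ε')`.
-/

open Set Complex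

/-- Abstract model of a contact manifold `Y` with a fixed contact form `α`. -/
structure ContactForm (Y : Type) [TopologicalSpace Y] where
  /-- The dimension of `Y`. -/
  dim : ℕ
  /-- The Reeb flow of `α`. -/
  reeb : ℝ → Y → Y
  reeb_zero : ∀ y, reeb 0 y = y
  reeb_add : ∀ s t y, reeb (s + t) y = reeb s (reeb t y)
  /-- `IsLegendrian Λ` : `Λ ⊆ Y` is an embedded Legendrian submanifold. -/
  IsLegendrian : Set Y → Prop
  /-- `IsLegRegularHomotopy i h` : `i` is a regular homotopy of Legendrians (a smooth
  family of Legendrian immersions `i_t : Λ → Y`) with contact Hamiltonian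
  `h_t(x) = α_{i_t(x)}(i'_t(x))`. -/
  IsLegRegularHomotopy : ∀ {Λ : Type}, (ℝ → Λ → Y) → (ℝ → Λ → ℝ) → Prop

/-- The oscillation energy `∫₀¹ (max h_t - min h_t) dt`. -/
noncomputable def oscEnergy {Λ : Type} (h : ℝ → Λ → ℝ) : ℝ :=
  ∫ t in (0:ℝ)..(1:ℝ), ((⨆ x, h t x) - ⨅ x, h t x)

/-- There is a Reeb chord between `A` and `B`. -/
def ContactForm.HasReebChordBetween {Y : Type} [TopologicalSpace Y]
    (C : ContactForm Y) (A B : Set Y) : Prop :=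
  ∃ t : ℝ, ∃ x ∈ A, C.reeb t x ∈ B

/-- The Liouville form `λ = ½(x dy - y dx)` of `ℂ` at `z` on the tangent vector `w`. -/
noncomputable def lambdaForm (z w : ℂ) : ℝ := (z.re * w.im - z.im * w.re) / 2

/-- The open disk `B(a) ⊆ ℂ` of area `a` (`π|z|² < a`). -/
def areaDisk (a : ℝ) : Set ℂ := {z : ℂ | Real.pi * Complex.normSq z < a}

/-- A smooth family of immersed Legendrian loops in the model `(ℝ/ℤ × ℂ, dt - λ)`,
written via `1`-periodic lifts: the loops are `s ↦ ((F t s : ℝ/ℤ), j t s)`. -/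
def IsModelLegFamily (F : ℝ → ℝ → ℝ) (j : ℝ → ℝ → ℂ) (d : ℤ) : Prop :=
  ContDiff ℝ (⊤ : ℕ∞) (fun p : ℝ × ℝ => (F p.1 p.2, j p.1 p.2)) ∧
  (∀ t s, F t (s + 1) = F t s + d) ∧
  (∀ t s, j t (s + 1) = j t s) ∧
  (∀ t s, deriv (F t) s = lambdaForm (j t s) (deriv (j t) s)) ∧
  (∀ t s, (deriv (F t) s, deriv (j t) s) ≠ (0, 0))

/-- The contact Hamiltonian `h_t = ∂ₜF - λ_j(∂ₜj)` of a model family of Legendrian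
loops, for the contact form `dt - λ`. -/
noncomputable def modelHam (F : ℝ → ℝ → ℝ) (j : ℝ → ℝ → ℂ) : ℝ → ℝ → ℝ :=
  fun t s => deriv (fun τ => F τ s) t - lambdaForm (j t s) (deriv (fun τ => j τ s) t)

section TrigCurve

variable {ι : Type*} [Fintype ι]

/-- The closed plane curve `∑ₐ cₐ(t) exp(2πi nₐ s)` with real Fourier coefficients. -/
noncomputable def trigCurve (n : ι → ℤ) (c : ι → ℝ → ℝ) (t s : ℝ) : ℂ :=
  ∑ a, (c a t : ℂ) * cexp ((2 * Real.pi * n a * s : ℝ) * I)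

/-- The primitive of `λ` along `trigCurve n c t` when this curve bounds area `d`. The diagonal
terms vanish. -/
noncomputable def trigPrimitive (d : ℤ) (n : ι → ℤ) (c : ι → ℝ → ℝ) (t s : ℝ) : ℝ :=
  d * s + ∑ a, ∑ b, c a t * c b t * (n b / (2 * (n b - n a))) *
    Real.sin (2 * Real.pi * (n b - n a) * s)

lemma lambdaForm_sum_exp (x y θ : ι → ℝ) :
    lambdaForm (∑ a, (x a : ℂ) * cexp (θ a * I)) (∑ b, (y b : ℂ) * cexp (θ b * I)) =
      (∑ a, ∑ b, x a * y b * Real.sin (θ b - θ a)) / 2 := by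
  simp only [lambdaForm, re_sum, im_sum, re_ofReal_mul, im_ofReal_mul, exp_ofReal_mul_I_re,
    exp_ofReal_mul_I_im, Finset.sum_mul_sum, ← Finset.sum_sub_distrib, Real.sin_sub]
  congr 1
  refine Finset.sum_congr rfl fun a _ => Finset.sum_congr rfl fun b _ => ?_
  ring

lemma lambdaForm_sum_exp_mul_I (x y θ : ι → ℝ) :
    lambdaForm (∑ a, (x a : ℂ) * cexp (θ a * I)) (∑ b, (y b : ℂ) * (cexp (θ b * I) * I)) =
      (∑ a, ∑ b, x a * y b * Real.cos (θ b - θ a)) / 2 := by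
  simp only [lambdaForm, re_sum, im_sum, re_ofReal_mul, im_ofReal_mul, exp_ofReal_mul_I_re,
    exp_ofReal_mul_I_im, mul_I_re, mul_I_im, Finset.sum_mul_sum, ← Finset.sum_sub_distrib,
    Real.cos_sub]
  congr 1
  refine Finset.sum_congr rfl fun a _ => Finset.sum_congr rfl fun b _ => ?_
  ring

lemma hasDerivAt_trigCurve_snd (n : ι → ℤ) (c : ι → ℝ → ℝ) (t s : ℝ) :
    HasDerivAt (trigCurve n c t)
      (∑ a, ((c a t * (2 * Real.pi * n a) : ℝ) : ℂ) *
        (cexp ((2 * Real.pi * n a * s : ℝ) * I) * I)) s := by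
  refine HasDerivAt.fun_sum fun a _ => ?_
  have h : HasDerivAt (fun s : ℝ => 2 * Real.pi * n a * s) (2 * Real.pi * n a) s := by
    simpa using (hasDerivAt_id s).const_mul (2 * Real.pi * n a)
  refine (((h.ofReal_comp.mul_const I).cexp).const_mul (c a t : ℂ)).congr_deriv ?_
  push_cast
  ring

lemma hasDerivAt_trigPrimitive_snd (d : ℤ) (n : ι → ℤ) (c : ι → ℝ → ℝ) (t s : ℝ) :
    HasDerivAt (trigPrimitive d n c t)
      (d + ∑ a, ∑ b, c a t * c b t * (n b / (2 * (n b - n a))) *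
        (Real.cos (2 * Real.pi * (n b - n a) * s) * (2 * Real.pi * (n b - n a)))) s := by
  refine HasDerivAt.add (by simpa using (hasDerivAt_id s).const_mul (d : ℝ))
    (HasDerivAt.fun_sum fun a _ => HasDerivAt.fun_sum fun b _ => ?_)
  refine HasDerivAt.const_mul _ (HasDerivAt.sin ?_)
  simpa using (hasDerivAt_id s).const_mul (2 * Real.pi * ((n b : ℝ) - n a))

lemma isModelLegFamily_trig {d : ℤ} {n : ι → ℤ} (hn : Function.Injective n) {c : ι → ℝ → ℝ}
    (hc : ∀ a, ContDiff ℝ (⊤ : ℕ∞) (c a)) (harea : ∀ t, Real.pi * ∑ a, n a * c a t ^ 2 = d)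
    (himm : ∀ t s, ∑ a, ((c a t * n a : ℝ) : ℂ) * cexp ((2 * Real.pi * n a * s : ℝ) * I) ≠ 0) :
    IsModelLegFamily (trigPrimitive d n c) (trigCurve n c) d := by
  classical
  refine ⟨?_, ?_, ?_, ?_, ?_⟩
  · have h : ContDiff ℝ (⊤ : ℕ∞) (fun x : ℝ => (x : ℂ)) := ofRealCLM.contDiff
    have hc' : ∀ a, ContDiff ℝ (⊤ : ℕ∞) (fun p : ℝ × ℝ => c a p.1) := fun a =>
      (hc a).comp contDiff_fst
    refine ContDiff.prodMk ?_ ?_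
    · unfold trigPrimitive
      refine ContDiff.add (by fun_prop) (ContDiff.sum fun a _ => ContDiff.sum fun b _ => ?_)
      exact (((hc' a).mul (hc' b)).mul contDiff_const).mul (by fun_prop)
    · unfold trigCurve
      refine ContDiff.sum fun a _ => (h.comp (hc' a)).mul (ContDiff.cexp (ContDiff.mul ?_
        contDiff_const))
      exact h.comp (f := fun p : ℝ × ℝ => 2 * Real.pi * n a * p.2) (by fun_prop)
  · intro t s
    have h : ∀ a b, Real.sin (2 * Real.pi * (n b - n a) * (s + 1)) =
        Real.sin (2 * Real.pi * (n b - n a) * s) := fun a b => by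
      rw [← Real.sin_add_int_mul_two_pi (2 * Real.pi * (n b - n a) * s) (n b - n a)]
      push_cast
      ring_nf
    simp only [trigPrimitive, h]
    ring
  · intro t s
    refine Finset.sum_congr rfl fun a _ => ?_
    congr 1
    rw [← exp_periodic.int_mul (n a) (((2 * Real.pi * n a * s : ℝ) : ℂ) * I)]
    push_cast
    ring_nf
  · intro t s
    rw [(hasDerivAt_trigCurve_snd n c t s).deriv, (hasDerivAt_trigPrimitive_snd d n c t s).deriv,
      trigCurve, lambdaForm_sum_exp_mul_I, ← harea t, Finset.mul_sum, ← Finset.sum_add_distrib,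
      Finset.sum_div]
    refine Finset.sum_congr rfl fun a _ => ?_
    rw [← Finset.add_sum_erase _ _ (Finset.mem_univ a),
      ← Finset.add_sum_erase (a := a) (Finset.univ) (fun b => c a t * (c b t * _) * _)
        (Finset.mem_univ a), add_div, Finset.sum_div, ← add_assoc]
    congr 1
    · simp
      ring
    · refine Finset.sum_congr rfl fun b hb => ?_
      have hba : (n b : ℝ) - n a ≠ 0 := by
        exact sub_ne_zero.2 fun h => Finset.ne_of_mem_erase hb (hn (Int.cast_injective h))
      rw [show 2 * Real.pi * (n b : ℝ) * s - 2 * Real.pi * n a * s =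
        2 * Real.pi * (n b - n a) * s by ring]
      field_simp
  · intro t s h
    refine himm t s ?_
    have h2 : deriv (trigCurve n c t) s = 0 := (Prod.ext_iff.1 h).2
    rw [(hasDerivAt_trigCurve_snd n c t s).deriv] at h2
    have h3 : (∑ a, ((c a t * n a : ℝ) : ℂ) * cexp ((2 * Real.pi * n a * s : ℝ) * I)) *
        (2 * Real.pi * I) = 0 := by
      rw [← h2, Finset.sum_mul]
      refine Finset.sum_congr rfl fun a _ => ?_
      push_cast
      ring
    exact (mul_eq_zero.1 h3).resolve_right two_pi_I_ne_zero

lemma modelHam_trig (d : ℤ) (n : ι → ℤ) {c : ι → ℝ → ℝ} {t : ℝ} {c' : ι → ℝ}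
    (hc : ∀ a, HasDerivAt (c a) (c' a) t) (s : ℝ) :
    modelHam (trigPrimitive d n c) (trigCurve n c) t s =
      ∑ a, ∑ b, ((c' a * c b t + c a t * c' b) * (n b / (2 * (n b - n a))) - c a t * c' b / 2) *
        Real.sin (2 * Real.pi * (n b - n a) * s) := by
  have h1 : HasDerivAt (fun τ => trigPrimitive d n c τ s)
      (∑ a, ∑ b, (c' a * c b t + c a t * c' b) * (n b / (2 * (n b - n a))) *
        Real.sin (2 * Real.pi * (n b - n a) * s)) t :=
    (HasDerivAt.fun_sum fun a _ => HasDerivAt.fun_sum fun b _ =>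
      (((hc a).mul (hc b)).mul_const _).mul_const _).const_add _
  have h2 : HasDerivAt (fun τ => trigCurve n c τ s)
      (∑ a, (c' a : ℂ) * cexp ((2 * Real.pi * n a * s : ℝ) * I)) t :=
    HasDerivAt.fun_sum fun a _ => (hc a).ofReal_comp.mul_const _
  rw [modelHam, h1.deriv, h2.deriv, trigCurve, lambdaForm_sum_exp]
  simp only [Finset.sum_div, ← Finset.sum_sub_distrib]
  refine Finset.sum_congr rfl fun a _ => Finset.sum_congr rfl fun b _ => ?_
  rw [show 2 * Real.pi * (n b : ℝ) * s - 2 * Real.pi * n a * s =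
    2 * Real.pi * (n b - n a) * s by ring]
  ring

lemma norm_trigCurve_le (n : ι → ℤ) (c : ι → ℝ → ℝ) (t s : ℝ) :
    ‖trigCurve n c t s‖ ≤ ∑ a, |c a t| := by
  refine (norm_sum_le _ _).trans (Finset.sum_le_sum fun a _ => ?_)
  rw [norm_mul, norm_exp_ofReal_mul_I, mul_one, norm_real, Real.norm_eq_abs]

end TrigCurve

lemma IsModelLegFamily.const {F : ℝ → ℝ → ℝ} {j : ℝ → ℝ → ℂ} {d : ℤ}
    (h : IsModelLegFamily F j d) (t : ℝ) :
    IsModelLegFamily (fun _ => F t) (fun _ => j t) d :=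
  ⟨h.1.comp (f := fun p : ℝ × ℝ => (t, p.2)) (by fun_prop), fun _ => h.2.1 t, fun _ => h.2.2.1 t,
    fun _ => h.2.2.2.1 t, fun _ => h.2.2.2.2 t⟩

lemma oscEnergy_le {Λ : Type} [Nonempty Λ] {h : ℝ → Λ → ℝ} {B : ℝ}
    (hB : ∀ t x, |h t x| ≤ B) : oscEnergy h ≤ 2 * B := by
  have h1 : ∀ t ∈ Set.uIoc (0 : ℝ) 1, ‖(⨆ x, h t x) - ⨅ x, h t x‖ ≤ 2 * B := fun t _ => by
    have hs : (⨆ x, h t x) ≤ B := ciSup_le fun x => (abs_le.1 (hB t x)).2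
    have hi : -B ≤ ⨅ x, h t x := le_ciInf fun x => (abs_le.1 (hB t x)).1
    have hle : (⨅ x, h t x) ≤ ⨆ x, h t x := ciInf_le_ciSup
      ⟨-B, by rintro _ ⟨x, rfl⟩; exact (abs_le.1 (hB t x)).1⟩
      ⟨B, by rintro _ ⟨x, rfl⟩; exact (abs_le.1 (hB t x)).2⟩
    rw [Real.norm_of_nonneg (sub_nonneg.2 hle)]
    linarith
  have h2 := intervalIntegral.norm_integral_le_of_norm_le_const h1
  rw [sub_zero, abs_one, mul_one] at h2
  exact (Real.le_norm_self _).trans h2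

section Wiggle

/-- The frequencies `1, m + 1, 2m + 1, 3m + 1`. -/
def wiggleFreq (m : ℕ) (a : Fin 4) : ℤ := m * a + 1

/-- A bounded smooth function of time with values in `(-1, 1)`. -/
noncomputable def wiggleParam (t : ℝ) : ℝ := 9 / 10 * Real.sin (Real.pi / 2 * t)

/-- The Fourier coefficients of `θ ↦ f (exp (iθ))`, where `f' z = (1 + q z ^ m) ^ 3` for
`q = wiggleParam t`. -/
noncomputable def wiggleCoeffAux (m : ℕ) (a : Fin 4) (t : ℝ) : ℝ :=
  Nat.choose 3 a * wiggleParam t ^ (a : ℕ) / (m * (a : ℕ) + 1)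

/-- The area bounded by the curve with coefficients `wiggleCoeffAux`, divided by `π`. -/
noncomputable def wiggleArea (m : ℕ) (t : ℝ) : ℝ :=
  ∑ a : Fin 4, (m * (a : ℕ) + 1) * wiggleCoeffAux m a t ^ 2

/-- The coefficients `wiggleCoeffAux`, rescaled so that the curve bounds area `1`. -/
noncomputable def wiggleCoeff (m : ℕ) (a : Fin 4) (t : ℝ) : ℝ :=
  (√(Real.pi * wiggleArea m t))⁻¹ * wiggleCoeffAux m a t

lemma wiggleFreq_injective {m : ℕ} (hm : 0 < m) : Function.Injective (wiggleFreq m) := by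
  intro a b h
  have h' : (m : ℤ) * a = m * b := by simpa [wiggleFreq] using h
  have h'' := mul_left_cancel₀ (by exact_mod_cast hm.ne') h'
  exact Fin.ext (by exact_mod_cast h'')

lemma contDiff_wiggleParam : ContDiff ℝ (⊤ : ℕ∞) wiggleParam := by
  unfold wiggleParam
  fun_prop

lemma hasDerivAt_wiggleParam (t : ℝ) :
    HasDerivAt wiggleParam (9 / 10 * (Real.cos (Real.pi / 2 * t) * (Real.pi / 2))) t :=
  (HasDerivAt.sin (by simpa using (hasDerivAt_id t).const_mul (Real.pi / 2))).const_mul _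

lemma abs_wiggleParam_lt (t : ℝ) : |wiggleParam t| < 1 := by
  have h := Real.abs_sin_le_one (Real.pi / 2 * t)
  rw [wiggleParam, abs_mul, abs_of_pos (by norm_num : (0 : ℝ) < 9 / 10)]
  linarith

lemma wiggleParam_zero : wiggleParam 0 = 0 := by simp [wiggleParam]

lemma wiggleParam_one : wiggleParam 1 = 9 / 10 := by simp [wiggleParam]

lemma contDiff_wiggleCoeffAux (m : ℕ) (a : Fin 4) :
    ContDiff ℝ (⊤ : ℕ∞) (wiggleCoeffAux m a) :=
  (contDiff_const.mul (contDiff_wiggleParam.pow _)).div_const _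

lemma wiggleCoeffAux_zero (m : ℕ) (t : ℝ) : wiggleCoeffAux m 0 t = 1 := by
  simp [wiggleCoeffAux]

lemma abs_wiggleCoeffAux_le (m : ℕ) (a : Fin 4) (t : ℝ) :
    |wiggleCoeffAux m a t| ≤ 3 * (1 / (m * (a : ℕ) + 1)) := by
  have hq : |wiggleParam t| ^ (a : ℕ) ≤ 1 := pow_le_one₀ (abs_nonneg _) (abs_wiggleParam_lt t).le
  have hk : (Nat.choose 3 a : ℝ) ≤ 3 := by
    exact_mod_cast (by decide : ∀ a : Fin 4, Nat.choose 3 a ≤ 3) a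
  rw [wiggleCoeffAux, abs_div, abs_of_pos (by positivity : (0 : ℝ) < m * (a : ℕ) + 1), abs_mul,
    abs_pow, Nat.abs_cast, mul_one_div]
  gcongr
  exact (mul_le_mul hk hq (by positivity) (by norm_num)).trans_eq (mul_one 3)

lemma abs_deriv_wiggleCoeffAux_le (m : ℕ) (a : Fin 4) (t : ℝ) :
    |deriv (wiggleCoeffAux m a) t| ≤ 18 * (1 / (m * (a : ℕ) + 1)) := by
  have h : HasDerivAt (wiggleCoeffAux m a) _ t :=
    (((hasDerivAt_wiggleParam t).fun_pow (a : ℕ)).const_mul (Nat.choose 3 a : ℝ)).div_const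
      (m * (a : ℕ) + 1 : ℝ)
  have hq : |wiggleParam t| ^ ((a : ℕ) - 1) ≤ 1 :=
    pow_le_one₀ (abs_nonneg _) (abs_wiggleParam_lt t).le
  have hk : (Nat.choose 3 a : ℝ) ≤ 3 := by
    exact_mod_cast (by decide : ∀ a : Fin 4, Nat.choose 3 a ≤ 3) a
  have ha : ((a : ℕ) : ℝ) ≤ 3 := by exact_mod_cast (by lia : (a : ℕ) ≤ 3)
  have hd : |9 / 10 * (Real.cos (Real.pi / 2 * t) * (Real.pi / 2))| ≤ 2 := by
    rw [abs_mul, abs_mul, abs_of_pos (by norm_num : (0 : ℝ) < 9 / 10),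
      abs_of_pos (by positivity : 0 < Real.pi / 2)]
    nlinarith [Real.abs_cos_le_one (Real.pi / 2 * t), Real.pi_lt_four, Real.pi_pos]
  rw [h.deriv, abs_div, abs_of_pos (by positivity : (0 : ℝ) < m * (a : ℕ) + 1), abs_mul, abs_mul,
    abs_mul, abs_pow, Nat.abs_cast, Nat.abs_cast, mul_one_div]
  gcongr
  calc _ ≤ (3 : ℝ) * (3 * 1 * 2) := by gcongr
    _ = 18 := by norm_num

lemma one_le_wiggleArea (m : ℕ) (t : ℝ) : 1 ≤ wiggleArea m t := by
  have h := Finset.single_le_sum (f := fun a : Fin 4 =>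
    ((m : ℝ) * (a : ℕ) + 1) * wiggleCoeffAux m a t ^ 2) (fun a _ => by positivity)
    (Finset.mem_univ 0)
  simpa [wiggleCoeffAux_zero, wiggleArea] using h

lemma contDiff_wiggleArea (m : ℕ) : ContDiff ℝ (⊤ : ℕ∞) (wiggleArea m) :=
  ContDiff.sum fun a _ => contDiff_const.mul ((contDiff_wiggleCoeffAux m a).pow 2)

lemma abs_deriv_wiggleArea_le (m : ℕ) (t : ℝ) : |deriv (wiggleArea m) t| ≤ 432 := by
  have h : HasDerivAt (wiggleArea m) _ t := HasDerivAt.fun_sum (u := Finset.univ) fun a _ =>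
    ((((contDiff_wiggleCoeffAux m a).differentiable (by simp) t).hasDerivAt.fun_pow 2).const_mul
      (m * (a : ℕ) + 1 : ℝ))
  rw [h.deriv]
  refine (Finset.abs_sum_le_sum_abs _ _).trans
    ((Finset.sum_le_card_nsmul _ _ 108 fun a _ => ?_).trans (by norm_num))
  have hpos : (1 : ℝ) ≤ m * (a : ℕ) + 1 := by
    have : (0 : ℝ) ≤ m * (a : ℕ) := by positivity
    linarith
  have h1 := abs_wiggleCoeffAux_le m a t
  have h2 := abs_deriv_wiggleCoeffAux_le m a t
  rw [abs_mul, abs_mul, abs_mul, abs_of_pos (by positivity : (0 : ℝ) < m * (a : ℕ) + 1)]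
  simp only [Nat.add_one_sub_one, pow_one, Nat.cast_ofNat, Nat.abs_ofNat]
  calc _ ≤ (m * (a : ℕ) + 1 : ℝ) * (2 * (3 * (1 / (m * (a : ℕ) + 1))) *
        (18 * (1 / (m * (a : ℕ) + 1)))) := by gcongr
    _ = 108 * (1 / (m * (a : ℕ) + 1)) := by
      field_simp
      norm_num
    _ ≤ 108 * 1 := by
      gcongr
      exact (div_le_one (by positivity)).2 hpos
    _ = 108 := mul_one _

lemma pi_mul_scale_sq (m : ℕ) (t : ℝ) :
    Real.pi * (√(Real.pi * wiggleArea m t))⁻¹ ^ 2 * wiggleArea m t = 1 := by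
  have h := one_le_wiggleArea m t
  have hpi := Real.pi_pos
  rw [inv_pow, Real.sq_sqrt (by positivity)]
  field_simp

lemma contDiff_scale (m : ℕ) :
    ContDiff ℝ (⊤ : ℕ∞) (fun t => (√(Real.pi * wiggleArea m t))⁻¹) := by
  have h : ∀ t, 0 < Real.pi * wiggleArea m t := fun t =>
    mul_pos Real.pi_pos (zero_lt_one.trans_le (one_le_wiggleArea m t))
  exact ((contDiff_const.mul (contDiff_wiggleArea m)).sqrt fun t => (h t).ne').inv
    fun t => (Real.sqrt_pos.2 (h t)).ne'

lemma scale_le_one (m : ℕ) (t : ℝ) : (√(Real.pi * wiggleArea m t))⁻¹ ≤ 1 := by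
  refine inv_le_one_of_one_le₀ (Real.one_le_sqrt.2 ?_)
  nlinarith [Real.pi_gt_three, one_le_wiggleArea m t]

lemma abs_deriv_scale_le (m : ℕ) (t : ℝ) :
    |deriv (fun t => (√(Real.pi * wiggleArea m t))⁻¹) t| ≤ 216 := by
  have hC := ((contDiff_scale m).differentiable (by simp) t).hasDerivAt
  have hS := ((contDiff_wiggleArea m).differentiable (by simp) t).hasDerivAt
  have h1 := ((hC.fun_pow 2).const_mul Real.pi).fun_mul hS
  simp only [pi_mul_scale_sq] at h1
  have h2 := h1.unique (hasDerivAt_const t (1 : ℝ))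
  have hS1 := one_le_wiggleArea m t
  have hC1 := scale_le_one m t
  have hC0 : 0 < (√(Real.pi * wiggleArea m t))⁻¹ := inv_pos.2 (Real.sqrt_pos.2
    (mul_pos Real.pi_pos (zero_lt_one.trans_le hS1)))
  have hS' := abs_deriv_wiggleArea_le m t
  set x := (√(Real.pi * wiggleArea m t))⁻¹
  set x' := deriv (fun t => (√(Real.pi * wiggleArea m t))⁻¹) t
  have h3 : x' * (2 * wiggleArea m t) = -(x * deriv (wiggleArea m) t) := by
    have h4 : Real.pi * x * (x' * (2 * wiggleArea m t) + x * deriv (wiggleArea m) t) = 0 := by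
      rw [← h2]
      push_cast
      ring
    rcases mul_eq_zero.1 h4 with h5 | h5
    · exact absurd h5 (mul_pos Real.pi_pos hC0).ne'
    · linarith
  have h6 := congrArg abs h3
  rw [abs_neg, abs_mul, abs_mul x, abs_of_pos hC0,
    abs_of_pos (by positivity : 0 < 2 * wiggleArea m t)] at h6
  nlinarith [abs_nonneg x', abs_nonneg (deriv (wiggleArea m) t)]

lemma contDiff_wiggleCoeff (m : ℕ) (a : Fin 4) : ContDiff ℝ (⊤ : ℕ∞) (wiggleCoeff m a) :=
  (contDiff_scale m).mul (contDiff_wiggleCoeffAux m a)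

lemma abs_wiggleCoeff_le (m : ℕ) (a : Fin 4) (t : ℝ) :
    |wiggleCoeff m a t| ≤ 3 * (1 / (m * (a : ℕ) + 1)) := by
  rw [wiggleCoeff, abs_mul, abs_of_nonneg (by positivity)]
  exact (mul_le_of_le_one_left (abs_nonneg _) (scale_le_one m t)).trans
    (abs_wiggleCoeffAux_le m a t)

lemma abs_deriv_wiggleCoeff_le (m : ℕ) (a : Fin 4) (t : ℝ) :
    |deriv (wiggleCoeff m a) t| ≤ 700 * (1 / (m * (a : ℕ) + 1)) := by
  have h : HasDerivAt (wiggleCoeff m a) _ t :=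
    ((contDiff_scale m).differentiable (by simp) t).hasDerivAt.mul
      ((contDiff_wiggleCoeffAux m a).differentiable (by simp) t).hasDerivAt
  have hw : (0 : ℝ) < 1 / (m * (a : ℕ) + 1) := by positivity
  rw [h.deriv]
  refine (abs_add_le _ _).trans ?_
  rw [abs_mul, abs_mul, abs_of_nonneg (by positivity : 0 ≤ (√(Real.pi * wiggleArea m t))⁻¹)]
  have h1 := mul_le_mul (abs_deriv_scale_le m t) (abs_wiggleCoeffAux_le m a t) (abs_nonneg _)
    (by norm_num)
  have h2 := mul_le_mul (scale_le_one m t) (abs_deriv_wiggleCoeffAux_le m a t) (abs_nonneg _)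
    zero_le_one
  linarith

/-- The primitive along the wiggled circle. -/
noncomputable abbrev wigglePrimitive (m : ℕ) : ℝ → ℝ → ℝ :=
  trigPrimitive 1 (wiggleFreq m) (wiggleCoeff m)

/-- The circle bounding area `1`, wiggled with `m`-fold rotational symmetry. -/
noncomputable abbrev wiggleCurve (m : ℕ) : ℝ → ℝ → ℂ :=
  trigCurve (wiggleFreq m) (wiggleCoeff m)

lemma isModelLegFamily_wiggle {m : ℕ} (hm : 0 < m) :
    IsModelLegFamily (wigglePrimitive m) (wiggleCurve m) 1 := by
  refine isModelLegFamily_trig (wiggleFreq_injective hm) (contDiff_wiggleCoeff m) (fun t => ?_)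
    fun t s => ?_
  · have h : ∑ a, wiggleFreq m a * wiggleCoeff m a t ^ 2 =
        (√(Real.pi * wiggleArea m t))⁻¹ ^ 2 * wiggleArea m t := by
      conv_rhs =>
        enter [2]
        rw [wiggleArea]
      rw [Finset.mul_sum]
      refine Finset.sum_congr rfl fun a _ => ?_
      simp only [wiggleFreq, wiggleCoeff]
      push_cast
      ring
    rw [h, Int.cast_one, ← mul_assoc, pi_mul_scale_sq]
  · have hC : (√(Real.pi * wiggleArea m t))⁻¹ ≠ 0 := inv_ne_zero (Real.sqrt_pos.2
      (mul_pos Real.pi_pos (zero_lt_one.trans_le (one_le_wiggleArea m t)))).ne'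
    have hsum : ∑ a, ((wiggleCoeff m a t * wiggleFreq m a : ℝ) : ℂ) *
        cexp ((2 * Real.pi * wiggleFreq m a * s : ℝ) * I) =
        ((√(Real.pi * wiggleArea m t))⁻¹ : ℝ) * cexp ((2 * Real.pi * s : ℝ) * I) *
          (wiggleParam t * cexp ((2 * Real.pi * m * s : ℝ) * I) + 1) ^ 3 := by
      rw [add_pow, Finset.sum_range, Finset.mul_sum]
      refine Finset.sum_congr rfl fun a _ => ?_
      have h1 : wiggleCoeff m a t * wiggleFreq m a =
          (√(Real.pi * wiggleArea m t))⁻¹ * (Nat.choose 3 a * wiggleParam t ^ (a : ℕ)) := by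
        have : (m * (a : ℕ) + 1 : ℝ) ≠ 0 := by positivity
        simp only [wiggleFreq, wiggleCoeff, wiggleCoeffAux]
        push_cast
        field_simp
      have h2 : cexp ((2 * Real.pi * wiggleFreq m a * s : ℝ) * I) =
          cexp ((2 * Real.pi * s : ℝ) * I) * cexp ((2 * Real.pi * m * s : ℝ) * I) ^ (a : ℕ) := by
        rw [← Complex.exp_nat_mul, ← Complex.exp_add, wiggleFreq]
        push_cast
        ring_nf
      rw [h1, h2, mul_pow]
      push_cast
      ring
    rw [hsum]
    refine mul_ne_zero (mul_ne_zero (ofReal_ne_zero.2 hC) (exp_ne_zero _)) (pow_ne_zero _ ?_)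
    intro h
    have h1 := congrArg norm (eq_neg_of_add_eq_zero_left h)
    rw [norm_mul, norm_exp_ofReal_mul_I, mul_one, norm_real, norm_neg, norm_one,
      Real.norm_eq_abs] at h1
    exact (abs_wiggleParam_lt t).ne h1

lemma wiggleCoeff_at_zero (m : ℕ) (a : Fin 4) :
    wiggleCoeff m a 0 = if a = 0 then (√Real.pi)⁻¹ else 0 := by
  have h : ∀ a : Fin 4, wiggleCoeffAux m a 0 = if a = 0 then 1 else 0 := fun a => by
    split_ifs with ha
    · rw [ha, wiggleCoeffAux_zero]
    · simp [wiggleCoeffAux, wiggleParam_zero, ha]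
  simp [wiggleCoeff, wiggleArea, h]

lemma wiggleCurve_at_zero (m : ℕ) (s : ℝ) :
    wiggleCurve m 0 s = ((√Real.pi)⁻¹ : ℝ) * cexp ((2 * Real.pi * s : ℝ) * I) := by
  simp [wiggleCurve, trigCurve, wiggleCoeff_at_zero, Fin.sum_univ_four, wiggleFreq]

lemma wigglePrimitive_at_zero (m : ℕ) (s : ℝ) : wigglePrimitive m 0 s = s := by
  simp [wigglePrimitive, trigPrimitive, wiggleCoeff_at_zero]

lemma pi_mul_normSq_wiggleCurve_le (m : ℕ) (t s : ℝ) :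
    Real.pi * normSq (wiggleCurve m t s) * wiggleArea m t ≤
      (∑ a, |wiggleCoeffAux m a t|) ^ 2 := by
  have h0 := zero_lt_one.trans_le (one_le_wiggleArea m t)
  have h := norm_trigCurve_le (wiggleFreq m) (wiggleCoeff m) t s
  have hC : 0 ≤ (√(Real.pi * wiggleArea m t))⁻¹ := by positivity
  simp only [wiggleCoeff, abs_mul, abs_of_nonneg hC, ← Finset.mul_sum] at h
  rw [normSq_eq_norm_sq]
  calc _ ≤ Real.pi * ((√(Real.pi * wiggleArea m t))⁻¹ * ∑ a, |wiggleCoeffAux m a t|) ^ 2 *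
        wiggleArea m t := by gcongr
    _ = (Real.pi * (√(Real.pi * wiggleArea m t))⁻¹ ^ 2 * wiggleArea m t) *
        (∑ a, |wiggleCoeffAux m a t|) ^ 2 := by ring
    _ = _ := by rw [pi_mul_scale_sq, one_mul]

lemma pi_mul_normSq_wiggleCurve_le_one_add {m : ℕ} (hm : 9 ≤ m) (t s : ℝ) :
    Real.pi * normSq (wiggleCurve m t s) ≤ 1 + 27 / m := by
  have hm' : (9 : ℝ) ≤ m := by exact_mod_cast hm
  have h1 := pi_mul_normSq_wiggleCurve_le m t s
  have h2 : ∑ a, |wiggleCoeffAux m a t| ≤ 1 + 9 / m := by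
    have h3 : ∀ a : Fin 4, 1 ≤ (a : ℕ) → |wiggleCoeffAux m a t| ≤ 3 * (1 / m) := fun a ha => by
      refine (abs_wiggleCoeffAux_le m a t).trans ?_
      have : (1 : ℝ) ≤ (a : ℕ) := by exact_mod_cast ha
      gcongr
      nlinarith
    rw [Fin.sum_univ_four, wiggleCoeffAux_zero, abs_one]
    have e1 := h3 1 (by decide)
    have e2 := h3 2 (by decide)
    have e3 := h3 3 (by decide)
    have : 9 / (m : ℝ) = 9 * (1 / m) := by ring
    linarith
  have h4 : (∑ a, |wiggleCoeffAux m a t|) ^ 2 ≤ (1 + 9 / (m : ℝ)) ^ 2 := by gcongr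
  have h5 : 9 / (m : ℝ) ≤ 1 := (div_le_one (by linarith)).2 hm'
  have h6 : 0 ≤ 9 / (m : ℝ) := by positivity
  have h7 : 27 / (m : ℝ) = 3 * (9 / m) := by ring
  have h8 : 0 ≤ Real.pi * normSq (wiggleCurve m t s) :=
    mul_nonneg Real.pi_pos.le (normSq_nonneg _)
  nlinarith [one_le_wiggleArea m t]

lemma pi_mul_normSq_wiggleCurve_one_lt {m : ℕ} (hm : 50 ≤ m) (s : ℝ) :
    Real.pi * normSq (wiggleCurve m 1 s) < 1 := by
  have hm' : (50 : ℝ) ≤ m := by exact_mod_cast hm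
  have h1 := pi_mul_normSq_wiggleCurve_le m 1 s
  refine lt_of_mul_lt_mul_right (h1.trans_lt ?_) (zero_le_one.trans (one_le_wiggleArea m 1))
  obtain ⟨u, hu⟩ : ∃ u : ℝ, u = 1 / (m + 1) := ⟨_, rfl⟩
  obtain ⟨v, hv⟩ : ∃ v : ℝ, v = 1 / (m * 2 + 1) := ⟨_, rfl⟩
  obtain ⟨w, hw⟩ : ∃ w : ℝ, w = 1 / (m * 3 + 1) := ⟨_, rfl⟩
  have hT : ∑ a, |wiggleCoeffAux m a 1| = 1 + 2.7 * u + 2.43 * v + 0.729 * w := by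
    have h0 : ∀ a, 0 ≤ wiggleCoeffAux m a 1 := fun a => by
      rw [wiggleCoeffAux, wiggleParam_one]
      positivity
    rw [Finset.sum_congr rfl fun a _ => abs_of_nonneg (h0 a)]
    simp only [Fin.sum_univ_four, wiggleCoeffAux, wiggleParam_one, hu, hv, hw]
    norm_num [Nat.choose]
    ring
  have hS : wiggleArea m 1 = 1 + 7.29 * u + 5.9049 * v + 0.531441 * w := by
    simp only [wiggleArea, Fin.sum_univ_four, wiggleCoeffAux, wiggleParam_one, hu, hv, hw]
    norm_num [Nat.choose]
    field_simp
    ring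
  have hu0 : 0 < u := by rw [hu]; positivity
  have hu1 : u ≤ 1 / 50 := by rw [hu]; gcongr; linarith
  have hv0 : 0.5 * u ≤ v := by
    rw [hu, hv, mul_one_div, div_le_div_iff₀ (by positivity) (by positivity)]
    linarith
  have hv1 : v ≤ 0.52 * u := by
    rw [hu, hv, mul_one_div, div_le_div_iff₀ (by positivity) (by positivity)]
    linarith
  have hw0 : 0 ≤ w := by rw [hw]; positivity
  have hw1 : w ≤ 0.35 * u := by
    rw [hu, hw, mul_one_div, div_le_div_iff₀ (by positivity) (by positivity)]
    linarith
  rw [hT, hS, one_mul]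
  calc (1 + 2.7 * u + 2.43 * v + 0.729 * w) ^ 2 ≤ (1 + 4.3 * u) ^ 2 := by
        refine pow_le_pow_left₀ (by linarith) (by linarith) 2
    _ < _ := by nlinarith

lemma abs_modelHam_wiggle_le {m : ℕ} (hm : 0 < m) (t s : ℝ) :
    |modelHam (wigglePrimitive m) (wiggleCurve m) t s| ≤ 16 * (5 * 700 ^ 2 / m) := by
  have hm' : (1 : ℝ) ≤ m := by exact_mod_cast hm
  have hw : ∀ a : Fin 4, (0 : ℝ) < 1 / (m * (a : ℕ) + 1) := fun a => by positivity
  have hcoeff : ∀ a, |wiggleCoeff m a t| ≤ 700 * (1 / (m * (a : ℕ) + 1)) := fun a =>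
    (abs_wiggleCoeff_le m a t).trans (by linarith [hw a])
  have hterm : ∀ a b : Fin 4,
      |((deriv (wiggleCoeff m a) t * wiggleCoeff m b t +
        wiggleCoeff m a t * deriv (wiggleCoeff m b) t) *
          (wiggleFreq m b / (2 * (wiggleFreq m b - wiggleFreq m a))) -
        wiggleCoeff m a t * deriv (wiggleCoeff m b) t / 2) *
        Real.sin (2 * Real.pi * (wiggleFreq m b - wiggleFreq m a) * s)| ≤ 5 * 700 ^ 2 / m := by
    intro a b
    rcases eq_or_ne a b with rfl | hab
    · simp only [sub_self, mul_zero, zero_mul, Real.sin_zero, abs_zero]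
      positivity
    have hprod : ∀ {x y : ℝ}, |x| ≤ 700 * (1 / (m * (a : ℕ) + 1)) →
        |y| ≤ 700 * (1 / (m * (b : ℕ) + 1)) → |x * y| ≤ 700 ^ 2 / m := by
      intro x y hx hy
      have hle : (m : ℝ) ≤ (m * (a : ℕ) + 1) * (m * (b : ℕ) + 1) := by
        have : 1 ≤ (a : ℕ) + b := by
          have := Fin.val_ne_of_ne hab
          lia
        have h1 : (1 : ℝ) ≤ (a : ℕ) + (b : ℕ) := by exact_mod_cast this
        have h2 : (0 : ℝ) ≤ (m * (a : ℕ)) * (m * (b : ℕ)) := by positivity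
        nlinarith
      calc |x * y| ≤ (700 * (1 / (m * (a : ℕ) + 1))) * (700 * (1 / (m * (b : ℕ) + 1))) := by
            rw [abs_mul]
            gcongr
        _ = 700 ^ 2 / ((m * (a : ℕ) + 1) * (m * (b : ℕ) + 1)) := by
            field_simp
        _ ≤ 700 ^ 2 / m := by gcongr
    have hr : |(wiggleFreq m b / (2 * (wiggleFreq m b - wiggleFreq m a)) : ℝ)| ≤ 2 := by
      have hdiff : (m : ℝ) ≤ |(wiggleFreq m b - wiggleFreq m a : ℝ)| := by
        have h1 : (1 : ℤ) ≤ |((b : ℕ) : ℤ) - (a : ℕ)| := by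
          refine Int.one_le_abs (sub_ne_zero.2 fun h => hab (Fin.ext ?_))
          exact_mod_cast h.symm
        have h2 : (1 : ℝ) ≤ |((b : ℕ) : ℝ) - (a : ℕ)| := by exact_mod_cast h1
        have h3 : (wiggleFreq m b - wiggleFreq m a : ℝ) = m * (((b : ℕ) : ℝ) - (a : ℕ)) := by
          simp only [wiggleFreq]
          push_cast
          ring
        rw [h3, abs_mul, Nat.abs_cast]
        exact le_mul_of_one_le_right (by positivity) h2
      have hnum : |(wiggleFreq m b : ℝ)| ≤ 4 * m := by
        have hb : ((b : ℕ) : ℝ) ≤ 3 := by exact_mod_cast (by lia : (b : ℕ) ≤ 3)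
        simp only [wiggleFreq]
        push_cast
        rw [abs_of_pos (by positivity)]
        nlinarith
      rw [abs_div, abs_mul, abs_two, div_le_iff₀ (by linarith)]
      linarith
    have h1 := hprod (abs_deriv_wiggleCoeff_le m a t) (hcoeff b)
    have h2 := hprod (hcoeff a) (abs_deriv_wiggleCoeff_le m b t)
    rw [abs_mul]
    refine (mul_le_of_le_one_right (abs_nonneg _) (Real.abs_sin_le_one _)).trans
      ((abs_sub _ _).trans ?_)
    rw [abs_mul, abs_div _ (2 : ℝ), abs_two]
    have h3 := mul_le_mul ((abs_add_le _ _).trans (add_le_add h1 h2)) hr (abs_nonneg _)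
      (by positivity)
    have h4 : 5 * 700 ^ 2 / (m : ℝ) = 5 * (700 ^ 2 / m) := by ring
    have h5 : (0 : ℝ) ≤ 700 ^ 2 / m := by positivity
    linarith
  rw [wigglePrimitive, wiggleCurve, modelHam_trig 1 (wiggleFreq m)
    (fun a => ((contDiff_wiggleCoeff m a).differentiable (by simp) t).hasDerivAt)]
  calc _ ≤ ∑ _a : Fin 4, ∑ _b : Fin 4, 5 * 700 ^ 2 / (m : ℝ) :=
        (Finset.abs_sum_le_sum_abs _ _).trans (Finset.sum_le_sum fun a _ =>
          (Finset.abs_sum_le_sum_abs _ _).trans (Finset.sum_le_sum fun b _ => hterm a b))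
    _ = 16 * (5 * 700 ^ 2 / m) := by
        simp only [Finset.sum_const, Finset.card_univ, Fintype.card_fin, nsmul_eq_mul]
        push_cast
        ring

end Wiggle

/-- Theorem 4 of the paper.  Let `(Y, ξ)` be a contact three-manifold
containing an embedded copy of `Q(1+ε) = ℝ/ℤ × B(1+ε)`, and let `α` be a contact form
on `Y` agreeing with `dt - λ` on `Q(1+ε')`, `0 < ε' < ε`.  Then `(Y, α)` contains an
embedded compact Legendrian `Λ₀` such that for every `δ > 0` there is a regular homotopy
of Legendrians starting at `Λ₀`, of oscillation energy `< δ`, leaving no Reeb chord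
between `Λ₀` and `Λ₁`. -/
theorem small_energy_disjoining_regular_homotopy
    {Y : Type} [TopologicalSpace Y] (C : ContactForm Y) (hdim : C.dim = 3)
    (ε ε' : ℝ) (hε' : 0 < ε') (hεε : ε' < ε)
    -- the embedding of `Q(1+ε)` into `Y`
    (e : AddCircle (1:ℝ) × ℂ → Y) (hec : Continuous e)
    (hei : Set.InjOn e (Set.univ ×ˢ areaDisk (1 + ε)))
    -- `α` agrees with `dt - λ` on `Q(1+ε')`: the Reeb flow is `∂ₜ` there …
    (hreeb : ∀ (θ : AddCircle (1:ℝ)) (z : ℂ), z ∈ areaDisk (1 + ε') → ∀ t : ℝ,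
      C.reeb t (e (θ, z)) = e (θ + (t : AddCircle (1:ℝ)), z))
    -- … closed Legendrian curves of the model contained in `Q(1+ε')` are Legendrians
    -- of `(Y, α)` …
    (hleg : ∀ (F₀ : ℝ → ℝ) (j₀ : ℝ → ℂ) (d : ℤ),
      IsModelLegFamily (fun _ => F₀) (fun _ => j₀) d →
      (∀ s, j₀ s ∈ areaDisk (1 + ε')) →
      Set.InjOn (fun s => (((F₀ s : ℝ) : AddCircle (1:ℝ)), j₀ s)) (Set.Ico (0:ℝ) 1) →
      C.IsLegendrian (Set.range (fun s => e (((F₀ s : ℝ) : AddCircle (1:ℝ)), j₀ s))))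
    -- … and model regular homotopies contained in `Q(1+ε')` are regular homotopies of
    -- Legendrians in `(Y, α)`, with the model contact Hamiltonian
    (hfam : ∀ (F : ℝ → ℝ → ℝ) (j : ℝ → ℝ → ℂ) (d : ℤ),
      IsModelLegFamily F j d → (∀ t s, j t s ∈ areaDisk (1 + ε')) →
      C.IsLegRegularHomotopy
        (fun t s => e (((F t s : ℝ) : AddCircle (1:ℝ)), j t s)) (modelHam F j)) :
    ∃ Λ₀ : Set Y, IsCompact Λ₀ ∧ C.IsLegendrian Λ₀ ∧
      ∀ δ > (0:ℝ), ∃ (Λty : Type) (i : ℝ → Λty → Y) (h : ℝ → Λty → ℝ),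
        C.IsLegRegularHomotopy i h ∧ Set.range (i 0) = Λ₀ ∧
        oscEnergy h < δ ∧
        ¬ C.HasReebChordBetween Λ₀ (Set.range (i 1)) := by
  have hε : areaDisk (1 + ε') ⊆ areaDisk (1 + ε) := fun z hz =>
    lt_trans (show _ < 1 + ε' from hz) (by linarith)
  have hcircle : ∀ (m : ℕ) (s : ℝ), Real.pi * normSq (wiggleCurve m 0 s) = 1 := fun m s => by
    rw [wiggleCurve_at_zero, normSq_eq_norm_sq, norm_mul, norm_exp_ofReal_mul_I, norm_real,
      Real.norm_of_nonneg (by positivity), mul_one, inv_pow, Real.sq_sqrt Real.pi_pos.le]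
    exact mul_inv_cancel₀ Real.pi_ne_zero
  have hmem : ∀ (m : ℕ) (s : ℝ), wiggleCurve m 0 s ∈ areaDisk (1 + ε') := fun m s =>
    show Real.pi * _ < _ by rw [hcircle]; linarith
  have hloop : ∀ m : ℕ, (fun s => e ((wigglePrimitive m 0 s : AddCircle (1 : ℝ)),
      wiggleCurve m 0 s)) = fun s => e ((wigglePrimitive 1 0 s : AddCircle (1 : ℝ)),
      wiggleCurve 1 0 s) := fun m => funext fun s => by
    rw [wiggleCurve_at_zero, wiggleCurve_at_zero, wigglePrimitive_at_zero,
      wigglePrimitive_at_zero]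
  have hmodel := (isModelLegFamily_wiggle one_pos).const 0
  refine ⟨Set.range fun s => e ((wigglePrimitive 1 0 s : AddCircle (1 : ℝ)), wiggleCurve 1 0 s),
    ?_, ?_, fun δ hδ => ?_⟩
  · refine Function.Periodic.compact_of_continuous (c := 1) (fun s => ?_) one_ne_zero ?_
    · simp only [hmodel.2.1 0 s, hmodel.2.2.1 0 s]
      simp
    · have h := hmodel.1.continuous.comp (Continuous.prodMk_right (0 : ℝ))
      exact hec.comp (((AddCircle.continuous_mk' 1).comp h.fst).prodMk h.snd)
  · refine hleg _ _ 1 hmodel (hmem 1) fun s hs s' hs' h => ?_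
    have h1 := (Prod.ext_iff.1 h).1
    simp only [wigglePrimitive_at_zero] at h1
    exact (AddCircle.coe_eq_coe_iff_of_mem_Ico (p := (1 : ℝ)) (a := 0) (by simpa using hs)
      (by simpa using hs')).1 h1
  · obtain ⟨m, hm⟩ := exists_nat_gt (max 50 (max (27 / ε') (160 * 700 ^ 2 / δ)))
    obtain ⟨hm1, hm'⟩ := max_lt_iff.1 hm
    obtain ⟨hm2, hm3⟩ := max_lt_iff.1 hm'
    have hm50 : 50 ≤ m := by exact_mod_cast hm1.le
    have hm0 : 0 < m := by lia
    have hm0' : (0 : ℝ) < m := by exact_mod_cast hm0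
    have hdisk : ∀ t s, wiggleCurve m t s ∈ areaDisk (1 + ε') := fun t s => by
      refine (pi_mul_normSq_wiggleCurve_le_one_add (by lia) t s).trans_lt ?_
      have := (div_lt_comm₀ hε' hm0').1 hm2
      linarith
    refine ⟨ℝ, _, _, hfam _ _ 1 (isModelLegFamily_wiggle hm0) hdisk, ?_, ?_, ?_⟩
    · exact congrArg Set.range (hloop m)
    · refine (oscEnergy_le (abs_modelHam_wiggle_le hm0)).trans_lt ?_
      have := (div_lt_comm₀ hδ hm0').1 hm3
      calc _ = 160 * 700 ^ 2 / (m : ℝ) := by ring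
        _ < δ := this
    · rintro ⟨t, _, ⟨s, rfl⟩, s', hs'⟩
      dsimp only at hs'
      rw [hreeb _ _ (hmem 1 s)] at hs'
      have h := (Prod.ext_iff.1 (hei ⟨Set.mem_univ _, hε (hdisk 1 s')⟩
        ⟨Set.mem_univ _, hε (hmem 1 s)⟩ hs')).2
      have h1 := pi_mul_normSq_wiggleCurve_one_lt hm50 s'
      dsimp only at h
      rw [h, hcircle] at h1
      exact lt_irrefl _ h1
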